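/- Let Ax ⊆ {em, t□, str, 4a}, where em := p∨¬p, t□ := (⊤⇛p)→p, str := (p→q)→(p⇛q), 4a := p⇛(⊤⇛p). Then HLC♭⊕Ax is sound and strongly complete with respect to the class of flat frames validating every formula of Ax: for all Γ ∪ {φ} ⊆ L⇛, Γ ⊢_Ax φ if and only if every flat frame validating every formula of Ax validates the consecution Γ ⇒ φ. -/

import Mathlib

/-- Formulas of the language `L⇛`. -/
inductive Fml : Type where
  | var : Nat → Fml
  | top : Fml
  | bot : Fml
  | and : Fml → Fml → Fml
  | or  : Fml → Fml → Fml
  | imp : Fml → Fml → Fml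
  | sto : Fml → Fml → Fml
deriving DecidableEq

/-- Uniform substitution. -/
def Fml.subst (σ : Nat → Fml) : Fml → Fml
  | .var p => σ p
  | .top => .top
  | .bot => .bot
  | .and φ ψ => .and (φ.subst σ) (ψ.subst σ)
  | .or φ ψ => .or (φ.subst σ) (ψ.subst σ)
  | .imp φ ψ => .imp (φ.subst σ) (ψ.subst σ)
  | .sto φ ψ => .sto (φ.subst σ) (ψ.subst σ)

/-- Conjunction `φ₁ ∧ ⋯ ∧ φₙ` of a list of formulas (`⊤` for the empty list). -/
def Fml.conj : List Fml → Fml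
  | [] => .top
  | [φ] => φ
  | φ :: ψ :: rest => .and φ (Fml.conj (ψ :: rest))

/-- Disjunction `φ₁ ∨ ⋯ ∨ φₙ` of a list of formulas (`⊥` for the empty list). -/
def Fml.disj : List Fml → Fml
  | [] => .bot
  | [φ] => φ
  | φ :: ψ :: rest => .or φ (Fml.disj (ψ :: rest))

/-- Axiom schemes of intuitionistic propositional logic (a standard Hilbert-style
axiomatisation); as schemes, they comprise all substitution instances. -/
inductive IpcAx : Fml → Prop where
  | k (φ ψ : Fml) : IpcAx (.imp φ (.imp ψ φ))
  | s (φ ψ χ : Fml) : IpcAx (.imp (.imp φ (.imp ψ χ)) (.imp (.imp φ ψ) (.imp φ χ)))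
  | andE1 (φ ψ : Fml) : IpcAx (.imp (.and φ ψ) φ)
  | andE2 (φ ψ : Fml) : IpcAx (.imp (.and φ ψ) ψ)
  | andI (φ ψ : Fml) : IpcAx (.imp φ (.imp ψ (.and φ ψ)))
  | orI1 (φ ψ : Fml) : IpcAx (.imp φ (.or φ ψ))
  | orI2 (φ ψ : Fml) : IpcAx (.imp ψ (.or φ ψ))
  | orE (φ ψ χ : Fml) : IpcAx (.imp (.imp φ χ) (.imp (.imp ψ χ) (.imp (.or φ ψ) χ)))
  | botE (φ : Fml) : IpcAx (.imp .bot φ)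
  | top : IpcAx .top

/-- Substitution instances of the axioms of intuitionistic logic together with
`k_a : ((p⇛q)∧(p⇛r))→(p⇛(q∧r))` and `tr : ((p⇛q)∧(q⇛r))→(p⇛r)`. -/
inductive BaseAx : Fml → Prop where
  | ipc {φ : Fml} : IpcAx φ → BaseAx φ
  | ka (φ ψ χ : Fml) : BaseAx (.imp (.and (.sto φ ψ) (.sto φ χ)) (.sto φ (.and ψ χ)))
  | tr (φ ψ χ : Fml) : BaseAx (.imp (.and (.sto φ ψ) (.sto ψ χ)) (.sto φ χ))

/-- Derivability of the consecution `Γ ⇒ φ` in `HLC♭ ⊕ Ax`, i.e. `Γ ⊢_Ax φ`. -/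
inductive Deriv (Ax : Set Fml) : Set Fml → Fml → Prop where
  | base {Γ : Set Fml} {φ : Fml} : BaseAx φ → Deriv Ax Γ φ
  | axm {Γ : Set Fml} {ψ : Fml} (σ : Nat → Fml) : ψ ∈ Ax → Deriv Ax Γ (ψ.subst σ)
  | el {Γ : Set Fml} {φ : Fml} : φ ∈ Γ → Deriv Ax Γ φ
  | mp {Γ : Set Fml} {φ ψ : Fml} : Deriv Ax Γ φ → Deriv Ax Γ (.imp φ ψ) → Deriv Ax Γ ψ
  | na {Γ : Set Fml} {φ ψ : Fml} : Deriv Ax (∅ : Set Fml) (.imp φ ψ) → Deriv Ax Γ (.sto φ ψ)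

/-- A flat frame: a nonempty set of worlds with a preorder `≼` and a relation `R`. -/
structure FlatFrame : Type 1 where
  W : Type
  ne : Nonempty W
  le : W → W → Prop
  le_refl : ∀ w, le w w
  le_trans : ∀ ⦃w v u⦄, le w v → le v u → le w u
  R : W → W → Prop

/-- A valuation is admissible if every proposition letter denotes an upset. -/
def FlatFrame.IsUpset (F : FlatFrame) (V : Nat → F.W → Prop) : Prop :=
  ∀ p ⦃w v⦄, F.le w v → V p w → V p v

/-- Truth of a formula at a world of a flat model: the usual intuitionistic Kripke
clauses over `≼`, and `w ⊨ φ⇛ψ` iff for every `w' ≽ w`, `R[w'] ⊆ ⟦φ⟧` implies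
`R[w'] ⊆ ⟦ψ⟧`. -/
def FlatFrame.sat (F : FlatFrame) (V : Nat → F.W → Prop) : Fml → F.W → Prop
  | .var p, w => V p w
  | .top, _ => True
  | .bot, _ => False
  | .and φ ψ, w => F.sat V φ w ∧ F.sat V ψ w
  | .or φ ψ, w => F.sat V φ w ∨ F.sat V ψ w
  | .imp φ ψ, w => ∀ v, F.le w v → F.sat V φ v → F.sat V ψ v
  | .sto φ ψ, w => ∀ w', F.le w w' →
      (∀ v, F.R w' v → F.sat V φ v) → ∀ v, F.R w' v → F.sat V ψ v

/-- A flat frame validates the consecution `Γ ⇒ φ` if in every model on it, every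
world satisfying all formulas of `Γ` satisfies `φ`. -/
def FlatFrame.ValidCons (F : FlatFrame) (Γ : Set Fml) (φ : Fml) : Prop :=
  ∀ V, F.IsUpset V → ∀ w, (∀ ψ ∈ Γ, F.sat V ψ w) → F.sat V φ w

/-- A flat frame validates a formula if it is true at every world in every model on it. -/
def FlatFrame.ValidFml (F : FlatFrame) (φ : Fml) : Prop :=
  ∀ V, F.IsUpset V → ∀ w, F.sat V φ w

/-- `em := p ∨ ¬p` (where `¬φ` abbreviates `φ→⊥`). -/
def emFml : Fml := .or (.var 0) (.imp (.var 0) .bot)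
/-- `t□ := (⊤⇛p)→p`. -/
def tbFml : Fml := .imp (.sto .top (.var 0)) (.var 0)
/-- `str := (p→q)→(p⇛q)`. -/
def strFml : Fml := .imp (.imp (.var 0) (.var 1)) (.sto (.var 0) (.var 1))
/-- `p_a := (p⇛q)→(⊤⇛(p⇛q))`. -/
def paFml : Fml := .imp (.sto (.var 0) (.var 1)) (.sto .top (.sto (.var 0) (.var 1)))
/-- `4a := p⇛(⊤⇛p)`. -/
def fourAFml : Fml := .sto (.var 0) (.sto .top (.var 0))
/-- `di := ((p⇛r)∧(q⇛r))→((p∨q)⇛r)`. -/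
def diFml : Fml := .imp (.and (.sto (.var 0) (.var 2)) (.sto (.var 1) (.var 2)))
    (.sto (.or (.var 0) (.var 1)) (.var 2))

namespace FlatFrame

theorem sat_mono (F : FlatFrame) {V : Nat → F.W → Prop} (hV : F.IsUpset V) (φ : Fml) :
    ∀ ⦃w v⦄, F.le w v → F.sat V φ w → F.sat V φ v := by
  induction φ with
  | var p => exact hV p
  | top => intros; trivial
  | bot => exact fun _ _ _ h => h
  | and φ ψ ihφ ihψ => exact fun w v h hw => ⟨ihφ h hw.1, ihψ h hw.2⟩
  | or φ ψ ihφ ihψ => exact fun w v h hw => hw.imp (ihφ h) (ihψ h)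
  | imp φ ψ => exact fun w v h hw u hu => hw u (F.le_trans h hu)
  | sto φ ψ => exact fun w v h hw u hu => hw u (F.le_trans h hu)

theorem sat_subst (F : FlatFrame) (V : Nat → F.W → Prop) (σ : Nat → Fml) (φ : Fml) :
    ∀ w, F.sat V (φ.subst σ) w ↔ F.sat (fun p => F.sat V (σ p)) φ w := by
  induction φ <;> simp_all [Fml.subst, sat]

theorem sat_of_baseAx (F : FlatFrame) {V : Nat → F.W → Prop} (hV : F.IsUpset V) {φ : Fml}
    (h : BaseAx φ) (w : F.W) : F.sat V φ w := by
  cases h with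
  | ipc h =>
    cases h with
    | k φ ψ => exact fun v _ hφ u hu _ => F.sat_mono hV φ hu hφ
    | s φ ψ χ =>
      exact fun v _ h₁ u hu h₂ t ht h₃ =>
        h₁ t (F.le_trans hu ht) h₃ t (F.le_refl t) (h₂ t ht h₃)
    | andE1 => exact fun _ _ h => h.1
    | andE2 => exact fun _ _ h => h.2
    | andI φ ψ => exact fun v _ hφ u hu hψ => ⟨F.sat_mono hV φ hu hφ, hψ⟩
    | orI1 => exact fun _ _ h => Or.inl h
    | orI2 => exact fun _ _ h => Or.inr h
    | orE φ ψ χ =>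
      exact fun v _ h₁ u hu h₂ t ht h₃ =>
        h₃.elim (h₁ t (F.le_trans hu ht)) (h₂ t ht)
    | botE => exact fun _ _ h => h.elim
    | top => trivial
  | ka φ ψ χ => exact fun v _ h u hu hφ t ht => ⟨h.1 u hu hφ t ht, h.2 u hu hφ t ht⟩
  | tr φ ψ χ => exact fun v _ h u hu hφ => h.2 u hu (h.1 u hu hφ)

end FlatFrame

namespace Deriv

variable {Ax Γ Δ : Set Fml} {φ ψ χ : Fml}

theorem sound (h : Deriv Ax Γ φ) (F : FlatFrame) (hF : ∀ ψ ∈ Ax, F.ValidFml ψ) :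
    F.ValidCons Γ φ := by
  induction h with
  | base h => exact fun V hV w _ => F.sat_of_baseAx hV h w
  | axm σ h =>
    exact fun V hV w _ => (F.sat_subst V σ _ w).2
      (hF _ h _ (fun p => F.sat_mono hV (σ p)) w)
  | el h => exact fun V hV w hw => hw _ h
  | mp _ _ ih₁ ih₂ => exact fun V hV w hw => ih₂ V hV w hw w (F.le_refl w) (ih₁ V hV w hw)
  | na _ ih =>
    exact fun V hV w _ u _ hφ v hv =>
      ih V hV v (by simp) v (F.le_refl v) (hφ v hv)

theorem weaken (h : Deriv Ax Γ φ) (hs : Γ ⊆ Δ) : Deriv Ax Δ φ := by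
  induction h with
  | base h => exact base h
  | axm σ h => exact axm σ h
  | el h => exact el (hs h)
  | mp _ _ ih₁ ih₂ => exact mp (ih₁ hs) (ih₂ hs)
  | na h _ => exact na h

theorem ipc (h : IpcAx φ) : Deriv Ax Γ φ := base (.ipc h)

theorem const (h : Deriv Ax Γ ψ) : Deriv Ax Γ (.imp φ ψ) := mp h (ipc (.k ψ φ))

theorem imp_self : Deriv Ax Γ (.imp φ φ) :=
  mp (ipc (.k φ φ)) (mp (ipc (.k φ (.imp φ φ))) (ipc (.s _ _ _)))

theorem and_intro (h₁ : Deriv Ax Γ φ) (h₂ : Deriv Ax Γ ψ) : Deriv Ax Γ (.and φ ψ) :=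
  mp h₂ (mp h₁ (ipc (.andI φ ψ)))

theorem imp_of_insert (h : Deriv Ax (insert φ Γ) ψ) : Deriv Ax Γ (.imp φ ψ) := by
  generalize hΔ : insert φ Γ = Δ at h
  induction h with
  | base h => exact const (base h)
  | axm σ h => exact const (axm σ h)
  | el h =>
    subst hΔ
    rcases h with rfl | h
    · exact imp_self
    · exact const (el h)
  | mp _ _ ih₁ ih₂ => exact mp (ih₁ hΔ) (mp (ih₂ hΔ) (ipc (.s _ _ _)))
  | na h _ => exact const (na h)

theorem exists_of_sUnion {c : Set (Set Fml)} (hc : IsChain (· ⊆ ·) c) (hne : c.Nonempty)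
    (h : Deriv Ax (⋃₀ c) φ) : ∃ S ∈ c, Deriv Ax S φ := by
  generalize hΔ : ⋃₀ c = Δ at h
  induction h with
  | base h => exact hne.imp fun S hS => ⟨hS, base h⟩
  | axm σ h => exact hne.imp fun S hS => ⟨hS, axm σ h⟩
  | el h =>
    subst hΔ
    obtain ⟨S, hS, h⟩ := h
    exact ⟨S, hS, el h⟩
  | mp _ _ ih₁ ih₂ =>
    obtain ⟨S, hS, h₁⟩ := ih₁ hΔ
    obtain ⟨T, hT, h₂⟩ := ih₂ hΔ
    rcases hc.total hS hT with hST | hTS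
    · exact ⟨T, hT, mp (h₁.weaken hST) h₂⟩
    · exact ⟨S, hS, mp h₁ (h₂.weaken hTS)⟩
  | na h _ => exact hne.imp fun S hS => ⟨hS, na h⟩

theorem sto_and (h₁ : Deriv Ax Γ (.sto φ ψ)) (h₂ : Deriv Ax Γ (.sto φ χ)) :
    Deriv Ax Γ (.sto φ (.and ψ χ)) :=
  mp (and_intro h₁ h₂) (base (.ka φ ψ χ))

theorem sto_trans (h₁ : Deriv Ax Γ (.sto φ ψ)) (h₂ : Deriv Ax Γ (.sto ψ χ)) :
    Deriv Ax Γ (.sto φ χ) :=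
  mp (and_intro h₁ h₂) (base (.tr φ ψ χ))

theorem and_imp_mp : Deriv Ax Γ (.imp (.and φ (.imp φ ψ)) ψ) :=
  imp_of_insert <| mp (mp (el (Set.mem_insert _ _)) (ipc (.andE1 _ _)))
    (mp (el (Set.mem_insert _ _)) (ipc (.andE2 _ _)))

/-- The formulas strictly implied by `φ` over `Γ` are closed under derivability. -/
theorem sto_of_deriv (h : Deriv Ax Δ χ) (hΔ : ∀ ψ ∈ Δ, Deriv Ax Γ (.sto φ ψ)) :
    Deriv Ax Γ (.sto φ χ) := by
  induction h with
  | base h => exact na (const (base h))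
  | axm σ h => exact na (const (axm σ h))
  | el h => exact hΔ _ h
  | mp _ _ ih₁ ih₂ => exact sto_trans (sto_and (ih₁ hΔ) (ih₂ hΔ)) (na and_imp_mp)
  | na h _ => exact na (const (na h))

end Deriv

/-- A set of formulas closed under derivability. -/
def IsTheory (Ax S : Set Fml) : Prop := ∀ φ, Deriv Ax S φ → φ ∈ S

/-- A consistent theory with the disjunction property. -/
structure IsPrimeTheory (Ax S : Set Fml) : Prop where
  closed : IsTheory Ax S
  bot_notMem : Fml.bot ∉ S
  mem_or : ∀ φ ψ, Fml.or φ ψ ∈ S → φ ∈ S ∨ ψ ∈ S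

theorem IsTheory.mp {Ax S : Set Fml} (hS : IsTheory Ax S) {φ ψ : Fml} (h : Fml.imp φ ψ ∈ S)
    (hφ : φ ∈ S) : ψ ∈ S :=
  hS _ (.mp (.el hφ) (.el h))

theorem IsTheory.mp_deriv {Ax S : Set Fml} (hS : IsTheory Ax S) {φ ψ : Fml}
    (h : Deriv Ax S (.imp φ ψ)) (hφ : φ ∈ S) : ψ ∈ S :=
  hS _ (.mp (.el hφ) h)

theorem exists_isPrimeTheory {Ax Γ : Set Fml} {φ : Fml} (h : ¬ Deriv Ax Γ φ) :
    ∃ Δ, Γ ⊆ Δ ∧ IsPrimeTheory Ax Δ ∧ φ ∉ Δ := by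
  obtain ⟨Δ, hΓΔ, hmax⟩ := zorn_subset_nonempty {S | ¬ Deriv Ax S φ}
    (fun c hcs hc hne => ⟨⋃₀ c, fun hd => by
      obtain ⟨S, hS, hd⟩ := hd.exists_of_sUnion hc hne
      exact hcs hS hd, fun S hS => Set.subset_sUnion_of_mem hS⟩) Γ h
  have hΔ : ¬ Deriv Ax Δ φ := hmax.prop
  have himp : ∀ ψ, ψ ∉ Δ → Deriv Ax Δ (.imp ψ φ) := by
    intro ψ hψ
    refine Deriv.imp_of_insert (by_contra fun hd => hψ ?_)
    exact hmax.le_of_ge (y := insert ψ Δ) hd (Set.subset_insert _ _) (Set.mem_insert _ _)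
  refine ⟨Δ, hΓΔ, ⟨fun ψ hψ => ?_, fun hb => ?_, fun ψ χ hor => ?_⟩, fun hφ => hΔ (.el hφ)⟩
  · by_contra hn
    exact hΔ (.mp hψ (himp ψ hn))
  · exact hΔ (.mp (.el hb) (.ipc (.botE φ)))
  · by_contra! hn
    exact hΔ (.mp (.el hor) (.mp (himp χ hn.2) (.mp (himp ψ hn.1) (.ipc (.orE ψ χ φ)))))

/-- Worlds of the canonical frame: a prime theory `thy` together with a theory `acc` cutting out
the set of accessible prime theories, closed under the strict implications in `thy`. -/
structure CanonWorld (Ax : Set Fml) where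
  thy : Set Fml
  acc : Set Fml
  prime : IsPrimeTheory Ax thy
  acc_closed : IsTheory Ax acc
  compat : ∀ φ ψ, Fml.sto φ ψ ∈ thy → φ ∈ acc → ψ ∈ acc

namespace CanonWorld

variable {Ax : Set Fml}

/-- The world over the prime theory `S` that accesses nothing. -/
def blind {S : Set Fml} (hS : IsPrimeTheory Ax S) : CanonWorld Ax where
  thy := S
  acc := Set.univ
  prime := hS
  acc_closed _ _ := trivial
  compat _ _ _ _ := trivial

/-- The world over the prime theory `S` accessing the prime theories that contain everything
strictly implied by `φ` according to `S`. -/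
def ofAntecedent {S : Set Fml} (hS : IsPrimeTheory Ax S) (φ : Fml) : CanonWorld Ax where
  thy := S
  acc := {χ | Fml.sto φ χ ∈ S}
  prime := hS
  acc_closed _ h := hS.closed _ (h.sto_of_deriv fun _ hψ => .el hψ)
  compat _ _ h hφ := hS.closed _ (Deriv.sto_trans (.el hφ) (.el h))

end CanonWorld

/-- The canonical flat frame. -/
def canonFrame (Ax : Set Fml) (hne : Nonempty (CanonWorld Ax)) : FlatFrame where
  W := CanonWorld Ax
  ne := hne
  le w v := w.thy ⊆ v.thy
  le_refl _ := subset_rfl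
  le_trans _ _ _ := Set.Subset.trans
  R w v := w.acc ⊆ v.thy

theorem canonFrame_sat {Ax : Set Fml} (hne : Nonempty (CanonWorld Ax)) (φ : Fml) :
    ∀ w : CanonWorld Ax,
      (canonFrame Ax hne).sat (fun p w => Fml.var p ∈ CanonWorld.thy w) φ w ↔ φ ∈ w.thy := by
  induction φ with
  | var p => exact fun w => Iff.rfl
  | top => exact fun w => ⟨fun _ => w.prime.closed _ (.ipc .top), fun _ => trivial⟩
  | bot => exact fun w => ⟨False.elim, w.prime.bot_notMem⟩
  | and φ ψ ihφ ihψ =>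
    intro w
    refine (and_congr (ihφ w) (ihψ w)).trans ⟨fun h => ?_, fun h => ⟨?_, ?_⟩⟩
    · exact w.prime.closed _ (.and_intro (.el h.1) (.el h.2))
    · exact w.prime.closed.mp_deriv (.ipc (.andE1 _ _)) h
    · exact w.prime.closed.mp_deriv (.ipc (.andE2 _ _)) h
  | or φ ψ ihφ ihψ =>
    intro w
    refine (or_congr (ihφ w) (ihψ w)).trans ⟨fun h => ?_, w.prime.mem_or φ ψ⟩
    rcases h with h | h
    · exact w.prime.closed.mp_deriv (.ipc (.orI1 _ _)) h
    · exact w.prime.closed.mp_deriv (.ipc (.orI2 _ _)) h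
  | imp φ ψ ihφ ihψ =>
    refine fun w => ⟨fun h => ?_, fun h v hv hφ => ?_⟩
    · by_contra hn
      obtain ⟨Δ, hs, hΔ, hψ⟩ := exists_isPrimeTheory (Ax := Ax) (Γ := insert φ w.thy) (φ := ψ)
        fun hd => hn (w.prime.closed _ hd.imp_of_insert)
      refine hψ ((ihψ (.blind hΔ)).1 (h _ ((Set.subset_insert _ _).trans hs) ?_))
      exact (ihφ (.blind hΔ)).2 (hs (Set.mem_insert _ _))
    · exact (ihψ v).2 (v.prime.closed.mp (hv h) ((ihφ v).1 hφ))
  | sto φ ψ ihφ ihψ =>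
    have box : ∀ (w : CanonWorld Ax) (χ : Fml),
        (∀ v : CanonWorld Ax, w.acc ⊆ v.thy → χ ∈ v.thy) → χ ∈ w.acc := by
      intro w χ h
      by_contra hn
      obtain ⟨Δ, hs, hΔ, hχ⟩ := exists_isPrimeTheory fun hd => hn (w.acc_closed χ hd)
      exact hχ (h (.blind hΔ) hs)
    refine fun w => ⟨fun h => ?_, fun h u hu hφ v hv => ?_⟩
    · refine box (.ofAntecedent w.prime φ) ψ fun v hv => (ihψ v).1 ?_
      refine h (CanonWorld.ofAntecedent w.prime φ) (subset_refl w.thy)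
        (fun t ht => (ihφ t).2 (ht ?_)) v hv
      exact w.prime.closed _ (.na .imp_self)
    · exact (ihψ v).2 (hv (u.compat φ ψ (hu h) (box u φ fun t ht => (ihφ t).1 (hφ t ht))))

theorem canonFrame_valid {Ax : Set Fml} (hAx : Ax ⊆ {emFml, tbFml, strFml, fourAFml})
    (hne : Nonempty (CanonWorld Ax)) : ∀ ψ ∈ Ax, (canonFrame Ax hne).ValidFml ψ := by
  intro ψ hψ V hV w
  rcases hAx hψ with rfl | rfl | rfl | rfl
  · by_cases hp : V 0 w
    · exact Or.inl hp
    refine Or.inr fun v hwv hv => hp (hV 0 (w := v) (fun χ hχ => ?_) hv)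
    have hem : Fml.or χ (.imp χ .bot) ∈ w.thy :=
      w.prime.closed _ (.axm (fun _ => χ) hψ)
    refine (w.prime.mem_or _ _ hem).resolve_right fun hn => ?_
    exact v.prime.bot_notMem (v.prime.closed.mp (hwv hn) hχ)
  · intro v _ h
    refine h (CanonWorld.ofAntecedent v.prime .top) (subset_refl v.thy)
      (fun _ _ => trivial) v fun χ hχ => ?_
    exact v.prime.closed.mp_deriv (.axm (fun _ => χ) hψ) hχ
  · intro v _ h u hu hp t ht
    refine h t (hu.trans (Set.Subset.trans (fun χ hχ => ?_) ht)) (hp t ht)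
    refine u.compat .top χ ?_ (u.acc_closed _ (.ipc .top))
    exact u.prime.closed.mp_deriv (.axm (fun n => if n = 0 then .top else χ) hψ)
      (u.prime.closed _ (.const (.el hχ)))
  · intro u _ hp v hv v' hv' _ t ht
    refine hp t (Set.Subset.trans (fun χ hχ => ?_) ht)
    have hbox : Fml.sto .top χ ∈ u.acc :=
      u.compat χ _ (u.prime.closed _ (.axm (fun _ => χ) hψ)) hχ
    exact v'.compat .top χ (hv' (hv hbox)) (v'.acc_closed _ (.ipc .top))

/-- for `Ax ⊆ {em, t□, str, 4a}`, the logic `HLC♭ ⊕ Ax` is sound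
and strongly complete with respect to the class of flat frames validating every
formula of `Ax`. -/
theorem sound_strongly_complete_em_tb_str_4a (Ax : Set Fml)
    (hAx : Ax ⊆ {emFml, tbFml, strFml, fourAFml}) (Γ : Set Fml) (φ : Fml) :
    Deriv Ax Γ φ ↔
      ∀ F : FlatFrame, (∀ ψ ∈ Ax, F.ValidFml ψ) → F.ValidCons Γ φ := by
  refine ⟨fun h F hF => h.sound F hF, fun h => by_contra fun hn => ?_⟩
  obtain ⟨Δ, hs, hΔ, hφ⟩ := exists_isPrimeTheory hn
  let w : CanonWorld Ax := .blind hΔ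
  refine hφ ((canonFrame_sat ⟨w⟩ φ w).1 (h _ (canonFrame_valid hAx ⟨w⟩) _ ?_ w ?_))
  · exact fun p _ _ huv hu => huv hu
  · exact fun ψ hψ => (canonFrame_sat ⟨w⟩ ψ w).2 (hs hψ)
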